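/- arXiv:2411.11007 — 3 statements merged into one kernel-verified Lean document; each statement's English description precedes it below -/
import Mathlib

section
/- For every w > 0, a_b > 0 and every real r, the fraction of beam power blocked by a disk of radius a_b whose center is at distance r from the beam center, I_b(r) = (2/(π w²)) ∬_{{(x,y) : x² + y² ≤ a_b²}} exp(-2((x - r)² + y²)/w²) dx dy, equals the one-dimensional integral √(2/π) · (1/w) · ∫_{-a_b}^{a_b} exp(-2(x - r)²/w²) · erf(√2 · √(a_b² - x²) / w) dx. -/
open Real MeasureTheory intervalIntegral

/-- The error function `erf x = (2/√π) ∫_0^x exp(-t²) dt`. -/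
noncomputable def erf (x : ℝ) : ℝ :=
  (2 / Real.sqrt Real.pi) * ∫ t in (0:ℝ)..x, Real.exp (-t ^ 2)

/-- Fubini's theorem on a disk centered at the origin. -/
theorem setIntegral_disk_eq {a : ℝ} (ha : 0 ≤ a) {f : ℝ × ℝ → ℝ} (hf : Continuous f) :
    ∫ p in {p : ℝ × ℝ | p.1 ^ 2 + p.2 ^ 2 ≤ a ^ 2}, f p =
      ∫ x in (-a)..a, ∫ y in (-√(a ^ 2 - x ^ 2))..√(a ^ 2 - x ^ 2), f (x, y) := by
  set S : Set (ℝ × ℝ) := {p | p.1 ^ 2 + p.2 ^ 2 ≤ a ^ 2} with hS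
  have hclosed : IsClosed S := isClosed_le (by fun_prop) continuous_const
  have hsub : S ⊆ Set.Icc (-a) a ×ˢ Set.Icc (-a) a := by
    intro p hp
    have hp' : p.1 ^ 2 + p.2 ^ 2 ≤ a ^ 2 := hp
    exact ⟨abs_le.mp (abs_le_of_sq_le_sq (by nlinarith [sq_nonneg p.2]) ha),
      abs_le.mp (abs_le_of_sq_le_sq (by nlinarith [sq_nonneg p.1]) ha)⟩
  have hcompact : IsCompact S := (isCompact_Icc.prod isCompact_Icc).of_isClosed_subset hclosed hsub
  have hint : Integrable (S.indicator f) :=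
    (integrable_indicator_iff hclosed.measurableSet).mpr (hf.continuousOn.integrableOn_compact hcompact)
  rw [← MeasureTheory.integral_indicator hclosed.measurableSet, Measure.volume_eq_prod,
    integral_prod _ (by simpa only [Measure.volume_eq_prod] using hint),
    integral_of_le (by linarith), ← integral_Icc_eq_integral_Ioc,
    ← MeasureTheory.integral_indicator measurableSet_Icc]
  congr 1
  ext x
  by_cases hx : x ∈ Set.Icc (-a) a
  · have hs : 0 ≤ √(a ^ 2 - x ^ 2) := Real.sqrt_nonneg _
    have hx2 : 0 ≤ a ^ 2 - x ^ 2 := by nlinarith [hx.1, hx.2]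
    rw [Set.indicator_of_mem hx, integral_of_le (by linarith), ← integral_Icc_eq_integral_Ioc,
      ← MeasureTheory.integral_indicator measurableSet_Icc]
    congr 1
    ext y
    have hiff : (x, y) ∈ S ↔ y ∈ Set.Icc (-√(a ^ 2 - x ^ 2)) √(a ^ 2 - x ^ 2) := by
      rw [Set.mem_Icc, ← abs_le, ← Real.sqrt_sq_eq_abs, Real.sqrt_le_sqrt_iff hx2]
      simp only [hS, Set.mem_ofPred_eq]
      constructor <;> intro h <;> linarith
    simp only [Set.indicator, hiff]
  · rw [Set.indicator_of_notMem hx]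
    have hzero : ∀ y, S.indicator f (x, y) = 0 := fun y =>
      Set.indicator_of_notMem (fun h => hx (hsub h).1) _
    simp [hzero]

/-- The integral of a centered Gaussian over a symmetric interval in terms of `erf`. -/
theorem integral_gaussian_symm_eq_erf {w : ℝ} (hw : 0 < w) (s : ℝ) :
    ∫ y in (-s)..s, Real.exp (-2 * y ^ 2 / w ^ 2) =
      w * √π / √2 * erf (√2 * s / w) := by
  have hcont : Continuous fun y : ℝ => Real.exp (-2 * y ^ 2 / w ^ 2) := by fun_prop
  have hc : √2 / w ≠ 0 := by positivity
  have hhalf : ∫ y in (-s)..0, Real.exp (-2 * y ^ 2 / w ^ 2) =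
      ∫ y in (0 : ℝ)..s, Real.exp (-2 * y ^ 2 / w ^ 2) := by
    have h := integral_comp_neg (a := 0) (b := s) fun y : ℝ => Real.exp (-2 * y ^ 2 / w ^ 2)
    simpa using h.symm
  have hscale : ∫ y in (0 : ℝ)..s, Real.exp (-2 * y ^ 2 / w ^ 2) =
      (√2 / w)⁻¹ * ∫ t in (0 : ℝ)..(√2 * s / w), Real.exp (-t ^ 2) := by
    have h := integral_comp_mul_left (a := 0) (b := s) (fun t : ℝ => Real.exp (-t ^ 2)) hc
    rw [mul_zero, smul_eq_mul, div_mul_eq_mul_div] at h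
    rw [← h]
    congr 1
    ext y
    rw [mul_pow, div_pow, Real.sq_sqrt (by norm_num)]
    congr 1
    ring
  rw [← integral_add_adjacent_intervals (hcont.intervalIntegrable (-s) 0)
    (hcont.intervalIntegrable 0 s), hhalf, hscale, erf]
  have hpi : √π ≠ 0 := by positivity
  field_simp
  ring

theorem stmt_2 (w ab r : ℝ) (hw : 0 < w) (hab : 0 < ab) :
    (2 / (Real.pi * w ^ 2)) *
      (∫ p in {p : ℝ × ℝ | p.1 ^ 2 + p.2 ^ 2 ≤ ab ^ 2},
        Real.exp (-2 * ((p.1 - r) ^ 2 + p.2 ^ 2) / w ^ 2)) =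
      Real.sqrt (2 / Real.pi) * (1 / w) *
        ∫ x in (-ab)..ab,
          Real.exp (-2 * (x - r) ^ 2 / w ^ 2) *
            erf (Real.sqrt 2 * Real.sqrt (ab ^ 2 - x ^ 2) / w) := by
  have hinner : ∀ x : ℝ, ∫ y in (-√(ab ^ 2 - x ^ 2))..√(ab ^ 2 - x ^ 2),
      Real.exp (-2 * ((x - r) ^ 2 + y ^ 2) / w ^ 2) =
      w * √π / √2 * (Real.exp (-2 * (x - r) ^ 2 / w ^ 2) * erf (√2 * √(ab ^ 2 - x ^ 2) / w)) := by
    intro x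
    have hsplit : ∀ y : ℝ, Real.exp (-2 * ((x - r) ^ 2 + y ^ 2) / w ^ 2) =
        Real.exp (-2 * (x - r) ^ 2 / w ^ 2) * Real.exp (-2 * y ^ 2 / w ^ 2) := by
      intro y
      rw [← Real.exp_add]
      congr 1
      ring
    simp only [hsplit]
    rw [intervalIntegral.integral_const_mul, integral_gaussian_symm_eq_erf hw]
    ring
  rw [setIntegral_disk_eq hab.le (by fun_prop)]
  simp only [hinner]
  rw [intervalIntegral.integral_const_mul, ← mul_assoc]
  congr 1
  rw [Real.sqrt_div (by norm_num)]
  have hpi : √π ^ 2 = π := Real.sq_sqrt Real.pi_pos.le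
  have htwo : √2 ^ 2 = (2 : ℝ) := Real.sq_sqrt (by norm_num)
  have hpos : 0 < √π := by positivity
  field_simp
  rw [hpi, htwo, mul_comm]
end

section
/- Fix w > 0 and a_b > 0, and define F(r) = (2/(π w²)) ∫_{-√π a_b/2}^{√π a_b/2} ∫_{-√π a_b/2}^{√π a_b/2} exp(-2((x - r)² + y²)/w²) dx dy. Then F(0) = C_0, the first derivative of F at 0 equals 0, and the second derivative of F at 0 equals 4 C_2 / w², where C_0 = (erf(√(π/2) · a_b/w))² and C_2 = -√2 · (a_b/w) · erf(√(π/2) · a_b/w) · exp(-π a_b²/(2 w²)). Equivalently, the second-order Taylor polynomial of F at r = 0 is C_0 + C_2 · (√2 r / w)². -/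
open Real MeasureTheory intervalIntegral

lemma hasDerivAt_erf (x : ℝ) :
    HasDerivAt erf (2 / Real.sqrt Real.pi * Real.exp (-x ^ 2)) x := by
  have hc : Continuous fun t : ℝ => Real.exp (-t ^ 2) := by fun_prop
  exact (hc.integral_hasStrictDerivAt 0 x).hasDerivAt.const_mul _

lemma erf_neg (x : ℝ) : erf (-x) = -erf x := by
  have h := integral_comp_neg (a := 0) (b := x) (fun t : ℝ => Real.exp (-t ^ 2))
  simp only [neg_sq, neg_zero] at h
  simp only [erf]
  rw [integral_symm, ← h]
  ring

lemma integral_exp_neg_mul_sub_sq {k : ℝ} (hk : k ≠ 0) (a b r : ℝ) :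
    ∫ x in a..b, Real.exp (-(k * (x - r)) ^ 2) =
      Real.sqrt Real.pi / (2 * k) * (erf (k * (b - r)) - erf (k * (a - r))) := by
  have hpi : Real.sqrt Real.pi ≠ 0 := (Real.sqrt_pos.2 Real.pi_pos).ne'
  rw [integral_eq_sub_of_hasDerivAt
    (f := fun x => Real.sqrt Real.pi / (2 * k) * erf (k * (x - r)))]
  · ring
  · intro x _
    have hin : HasDerivAt (fun x : ℝ => k * (x - r)) (k * 1) x :=
      ((hasDerivAt_id x).sub_const r).const_mul k
    have h := ((hasDerivAt_erf (k * (x - r))).comp x hin).const_mul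
      (Real.sqrt Real.pi / (2 * k))
    refine h.congr_deriv ?_
    field_simp
  · exact Continuous.intervalIntegrable (by fun_prop) _ _

/-- The power of a Gaussian beam through a centred square of half-side `s`, as a function of the
displacement `r` of the beam. -/
lemma integral_integral_exp_eq_erf {w : ℝ} (hw : 0 < w) (s r : ℝ) :
    (2 / (Real.pi * w ^ 2)) * (∫ y in (-s)..s, ∫ x in (-s)..s,
      Real.exp (-2 * ((x - r) ^ 2 + y ^ 2) / w ^ 2)) =
    1 / 2 * erf (Real.sqrt 2 / w * s) *
      (erf (Real.sqrt 2 / w * (s + r)) + erf (Real.sqrt 2 / w * (s - r))) := by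
  have h2 : Real.sqrt 2 ^ 2 = 2 := Real.sq_sqrt (by norm_num)
  have hpi : Real.sqrt Real.pi ^ 2 = Real.pi := Real.sq_sqrt Real.pi_pos.le
  have hpi0 := Real.pi_pos
  set k := Real.sqrt 2 / w with hk
  have hk0 : 0 < k := by positivity
  have hk2 : k ^ 2 = 2 / w ^ 2 := by rw [hk, div_pow, h2]
  have hsplit : ∀ x y : ℝ, Real.exp (-2 * ((x - r) ^ 2 + y ^ 2) / w ^ 2) =
      Real.exp (-(k * (y - 0)) ^ 2) * Real.exp (-(k * (x - r)) ^ 2) := by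
    intro x y
    rw [← Real.exp_add, mul_pow, mul_pow, hk2]
    congr 1
    ring
  simp only [hsplit, intervalIntegral.integral_const_mul, intervalIntegral.integral_mul_const,
    integral_exp_neg_mul_sub_sq hk0.ne']
  rw [show k * (-s - 0) = -(k * s) by ring, show k * (-s - r) = -(k * (s + r)) by ring,
    show k * (s - 0) = k * s by ring, erf_neg, erf_neg]
  have hconst : 2 / (Real.pi * w ^ 2) *
      (Real.sqrt Real.pi / (2 * k) * (Real.sqrt Real.pi / (2 * k))) = 1 / 4 := by
    have : Real.sqrt Real.pi / (2 * k) * (Real.sqrt Real.pi / (2 * k)) =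
        Real.pi / (4 * k ^ 2) := by
      rw [div_mul_div_comm, ← sq, hpi]
      ring
    rw [this, hk2]
    field_simp
  linear_combination (2 * erf (k * s) * (erf (k * (s + r)) + erf (k * (s - r)))) * hconst

lemma hasDerivAt_erf_add_erf (k s r : ℝ) :
    HasDerivAt (fun r => erf (k * (s + r)) + erf (k * (s - r)))
      (2 * k / Real.sqrt Real.pi *
        (Real.exp (-(k * (s + r)) ^ 2) - Real.exp (-(k * (s - r)) ^ 2))) r := by
  have h₁ : HasDerivAt (fun r : ℝ => k * (s + r)) (k * 1) r :=
    ((hasDerivAt_id r).const_add s).const_mul k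
  have h₂ : HasDerivAt (fun r : ℝ => k * (s - r)) (k * -1) r :=
    ((hasDerivAt_id r).const_sub s).const_mul k
  refine (((hasDerivAt_erf _).comp r h₁).add ((hasDerivAt_erf _).comp r h₂)).congr_deriv ?_
  ring

lemma hasDerivAt_exp_sub_exp_zero (k s : ℝ) :
    HasDerivAt (fun r => Real.exp (-(k * (s + r)) ^ 2) - Real.exp (-(k * (s - r)) ^ 2))
      (-4 * k ^ 2 * s * Real.exp (-(k * s) ^ 2)) 0 := by
  have h₁ : HasDerivAt (fun r : ℝ => k * (s + r)) (k * 1) 0 :=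
    ((hasDerivAt_id 0).const_add s).const_mul k
  have h₂ : HasDerivAt (fun r : ℝ => k * (s - r)) (k * -1) 0 :=
    ((hasDerivAt_id 0).const_sub s).const_mul k
  refine ((h₁.pow 2).neg.exp.sub (h₂.pow 2).neg.exp).congr_deriv ?_
  simp
  ring

theorem stmt_4 (w ab : ℝ) (hw : 0 < w) (hab : 0 < ab)
    (F : ℝ → ℝ)
    (hF : ∀ r : ℝ, F r = (2 / (Real.pi * w ^ 2)) *
      (∫ y in (-(Real.sqrt Real.pi * ab / 2))..(Real.sqrt Real.pi * ab / 2),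
        ∫ x in (-(Real.sqrt Real.pi * ab / 2))..(Real.sqrt Real.pi * ab / 2),
          Real.exp (-2 * ((x - r) ^ 2 + y ^ 2) / w ^ 2)))
    (C0 C2 : ℝ)
    (hC0 : C0 = (erf (Real.sqrt (Real.pi / 2) * ab / w)) ^ 2)
    (hC2 : C2 = -(Real.sqrt 2) * (ab / w) * erf (Real.sqrt (Real.pi / 2) * ab / w) *
      Real.exp (-(Real.pi * ab ^ 2) / (2 * w ^ 2))) :
    F 0 = C0 ∧ deriv F 0 = 0 ∧ deriv (deriv F) 0 = 4 * C2 / w ^ 2 := by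
  have h2 : Real.sqrt 2 ^ 2 = 2 := Real.sq_sqrt (by norm_num)
  have hpi : Real.sqrt Real.pi ^ 2 = Real.pi := Real.sq_sqrt Real.pi_pos.le
  have hpi0 : 0 < Real.sqrt Real.pi := Real.sqrt_pos.2 Real.pi_pos
  have harg : Real.sqrt (Real.pi / 2) * ab / w =
      Real.sqrt 2 / w * (Real.sqrt Real.pi * ab / 2) := by
    rw [Real.sqrt_div Real.pi_pos.le]
    field_simp
    rw [h2]
  have hexp : -(Real.pi * ab ^ 2) / (2 * w ^ 2) =
      -(Real.sqrt 2 / w * (Real.sqrt Real.pi * ab / 2)) ^ 2 := by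
    rw [mul_pow, div_pow, div_pow, mul_pow, h2, hpi]
    field_simp
  rw [harg] at hC0 hC2
  rw [hexp] at hC2
  have hks : (Real.sqrt 2 / w) ^ 3 * (Real.sqrt Real.pi * ab / 2) / Real.sqrt Real.pi =
      Real.sqrt 2 * ab / w ^ 3 := by
    rw [div_pow, pow_succ, h2]
    field_simp
  simp only [integral_integral_exp_eq_erf hw] at hF
  set s := Real.sqrt Real.pi * ab / 2
  set k := Real.sqrt 2 / w
  have hderiv : deriv F = fun r => 1 / 2 * erf (k * s) * (2 * k / Real.sqrt Real.pi *
      (Real.exp (-(k * (s + r)) ^ 2) - Real.exp (-(k * (s - r)) ^ 2))) := by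
    funext r
    rw [funext hF]
    exact ((hasDerivAt_erf_add_erf k s r).const_mul _).deriv
  refine ⟨?_, ?_, ?_⟩
  · rw [hF, hC0, add_zero, sub_zero]
    ring
  · simp [hderiv]
  · rw [hderiv, (((hasDerivAt_exp_sub_exp_zero k s).const_mul _).const_mul _).deriv, hC2]
    linear_combination (-4 * erf (k * s) * Real.exp (-(k * s) ^ 2)) * hks
end

section
/- Let 0 ≤ A₁ < A₂ be reals and let μ be the uniform probability measure on the interval [A₁, A₂] (Lebesgue measure restricted to [A₁, A₂] and normalized by 1/(A₂ - A₁)). Let k > 0, C₀ > 0, and let E, T be reals with 0 < E - T ≤ C₀. Set B = √( (1/k) · ln( C₀/(E - T) ) ). If A₁ ≤ B ≤ A₂, then μ{ x : E - C₀ · exp(-k x²) ≤ T } = (B - A₁)/(A₂ - A₁). -/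
open Real MeasureTheory

theorem sub_mul_exp_neg_mul_sq_le_iff {k C E T x : ℝ} (hk : 0 < k) (hC : 0 < C)
    (hET : 0 < E - T) (hETC : E - T ≤ C) :
    E - C * Real.exp (-k * x ^ 2) ≤ T ↔ |x| ≤ √((1 / k) * Real.log (C / (E - T))) := by
  have hlog : 0 ≤ (1 / k) * Real.log (C / (E - T)) :=
    mul_nonneg (by positivity) (Real.log_nonneg ((one_le_div hET).2 hETC))
  rw [Real.le_sqrt (abs_nonneg x) hlog, sq_abs, one_div, le_inv_mul_iff₀ hk,
    Real.le_log_iff_exp_le (by positivity), le_div_iff₀ hET, neg_mul, Real.exp_neg,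
    ← div_eq_mul_inv, sub_le_comm, le_div_iff₀ (Real.exp_pos _), mul_comm (E - T)]

theorem stmt_12 (A₁ A₂ : ℝ) (hA₁ : 0 ≤ A₁) (hA : A₁ < A₂)
    (μ : Measure ℝ)
    (hμ : μ = (ENNReal.ofReal (A₂ - A₁))⁻¹ • volume.restrict (Set.Icc A₁ A₂))
    (k C₀ E T : ℝ) (hk : 0 < k) (hC₀ : 0 < C₀)
    (hET : 0 < E - T) (hETC : E - T ≤ C₀)
    (B : ℝ) (hB : B = Real.sqrt ((1 / k) * Real.log (C₀ / (E - T))))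
    (hB₁ : A₁ ≤ B) (hB₂ : B ≤ A₂) :
    μ {x : ℝ | E - C₀ * Real.exp (-k * x ^ 2) ≤ T} =
      ENNReal.ofReal ((B - A₁) / (A₂ - A₁)) := by
  have hset : {x : ℝ | E - C₀ * Real.exp (-k * x ^ 2) ≤ T} = Set.Icc (-B) B := by
    ext x
    rw [Set.mem_ofPred_eq, sub_mul_exp_neg_mul_sq_le_iff hk hC₀ hET hETC, ← hB, abs_le,
      Set.mem_Icc]
  rw [hset, hμ, Measure.smul_apply, Measure.restrict_apply measurableSet_Icc,
    Set.Icc_inter_Icc, max_eq_right (by linarith), min_eq_left hB₂, Real.volume_Icc,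
    ENNReal.ofReal_div_of_pos (sub_pos.2 hA), smul_eq_mul, mul_comm, div_eq_mul_inv]
end
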